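/- Let $\beta\in\{1,2\}$ and $r\geq\beta$. Let $X\in[0,1]^{N\times N}$ have every column $\underline{x}_i$ satisfying $\|(D^{\beta})^T\underline{x}_i\|_0\leq s$, and let $q\in\mathbb{R}^{N\times N}$ be such that each column $\underline{q}_i$ satisfies $\|D^{-r}(\underline{x}_i-\underline{q}_i)\|_\infty\leq\delta/2$. Let $\hat{X}$ be the matrix whose $i$-th column $\hat{\underline{x}}_i$ minimizes $\|(D^{\beta})^T z\|_1$ over $\{z:\|D^{-r}(z-\underline{q}_i)\|_\infty\leq\delta/2\}$. Then $\|\hat{X}-X\|_F\leq C\sqrt{sN}\,\delta$, where $C$ depends only on $r$. -/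

import Mathlib

open scoped BigOperators
open Finset Matrix

/-- The `N × N` finite difference matrix with `1`s on the diagonal and `-1`s on
the subdiagonal. -/
noncomputable def Dmat (N : ℕ) : Matrix (Fin N) (Fin N) ℝ :=
  Matrix.of fun i j => if i = j then 1 else if (j : ℕ) + 1 = (i : ℕ) then -1 else 0

/-- Entrywise ℓ¹ norm of a vector. -/
noncomputable def l1 {N : ℕ} (v : Fin N → ℝ) : ℝ := ∑ i, |v i|

/-- Number of nonzero entries of a vector (the "ℓ⁰ norm"). -/
noncomputable def sparsity {N : ℕ} (v : Fin N → ℝ) : ℕ :=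
  (Finset.univ.filter (fun i => v i ≠ 0)).card

/-- Frobenius norm of a matrix. -/
noncomputable def frob {N : ℕ} (A : Matrix (Fin N) (Fin N) ℝ) : ℝ :=
  Real.sqrt (∑ i, ∑ j, (A i j) ^ 2)


lemma Dmat_abs_le {N : ℕ} (i j : Fin N) :
    |Dmat N i j| ≤ (if i = j then 1 else 0) + (if (j : ℕ) + 1 = (i : ℕ) then 1 else 0) := by
  simp only [Dmat, Matrix.of_apply]
  split_ifs <;> norm_num

lemma Dmat_row {N : ℕ} (i : Fin N) : ∑ j, |Dmat N i j| ≤ 2 := by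
  refine (Finset.sum_le_sum fun j _ => Dmat_abs_le i j).trans ?_
  rw [Finset.sum_add_distrib]
  have h2 : ∑ j : Fin N, (if (j : ℕ) + 1 = (i : ℕ) then (1 : ℝ) else 0) ≤ 1 := by
    rw [Finset.sum_boole]
    exact_mod_cast Finset.card_le_one.2 (by
      intro a ha b hb
      simp only [Finset.mem_filter, Finset.mem_univ, true_and] at ha hb
      exact Fin.ext (by omega))
  have h1 : ∑ j : Fin N, (if i = j then (1 : ℝ) else 0) = 1 := by simp
  linarith

lemma Dmat_col {N : ℕ} (j : Fin N) : ∑ i, |Dmat N i j| ≤ 2 := by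
  refine (Finset.sum_le_sum fun i _ => Dmat_abs_le i j).trans ?_
  rw [Finset.sum_add_distrib]
  have h2 : ∑ i : Fin N, (if (j : ℕ) + 1 = (i : ℕ) then (1 : ℝ) else 0) ≤ 1 := by
    rw [Finset.sum_boole]
    exact_mod_cast Finset.card_le_one.2 (by
      intro a ha b hb
      simp only [Finset.mem_filter, Finset.mem_univ, true_and] at ha hb
      exact Fin.ext (by omega))
  have h1 : ∑ i : Fin N, (if i = j then (1 : ℝ) else 0) = 1 := by simp
  linarith

lemma mulVec_bound {N : ℕ} (A : Matrix (Fin N) (Fin N) ℝ) (hA : ∀ i, ∑ j, |A i j| ≤ 2)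
    (v : Fin N → ℝ) (M : ℝ) (hv : ∀ i, |v i| ≤ M) (i : Fin N) :
    |(A.mulVec v) i| ≤ 2 * M := by
  have hM : 0 ≤ M := (abs_nonneg _).trans (hv i)
  calc |(A.mulVec v) i| = |∑ j, A i j * v j| := rfl
    _ ≤ ∑ j, |A i j * v j| := Finset.abs_sum_le_sum_abs _ _
    _ ≤ ∑ j, |A i j| * M := Finset.sum_le_sum fun j _ => by
        rw [abs_mul]; exact mul_le_mul_of_nonneg_left (hv j) (abs_nonneg _)
    _ = (∑ j, |A i j|) * M := by rw [Finset.sum_mul]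
    _ ≤ 2 * M := mul_le_mul_of_nonneg_right (hA i) hM

lemma pow_mulVec_bound {N : ℕ} (A : Matrix (Fin N) (Fin N) ℝ) (hA : ∀ i, ∑ j, |A i j| ≤ 2)
    (k : ℕ) (v : Fin N → ℝ) (M : ℝ) (hv : ∀ i, |v i| ≤ M) (i : Fin N) :
    |((A ^ k).mulVec v) i| ≤ 2 ^ k * M := by
  induction k generalizing i with
  | zero => simpa using hv i
  | succ k ih =>
    rw [pow_succ', ← Matrix.mulVec_mulVec, pow_succ', mul_assoc]
    exact mulVec_bound A hA _ _ ih i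

lemma Dmat_det (N : ℕ) : (Dmat N).det = 1 := by
  rw [Matrix.det_of_isLowerTriangular]
  · simp [Dmat]
  · intro i j hij
    have hij' : (i : ℕ) < (j : ℕ) := hij
    have h1 : i ≠ j := fun h => by subst h; omega
    have h2 : ¬ ((j : ℕ) + 1 = (i : ℕ)) := by omega
    simp [Dmat, h1, h2]

lemma cone {N : ℕ} (a b : Fin N → ℝ) (M : ℝ) (s : ℕ) (hs : sparsity a ≤ s)
    (hM : 0 ≤ M) (hb : ∀ i, |b i| ≤ M) (h : l1 (a + b) ≤ l1 a) : l1 b ≤ 2 * (s * M) := by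
  have key : ∀ i, |b i| ≤ |(a + b) i| - |a i| + 2 * (if a i ≠ 0 then M else 0) := by
    intro i
    simp only [Pi.add_apply]
    by_cases h0 : a i = 0
    · simp [h0]
    · have := abs_sub (a i + b i) (b i)
      have h3 := hb i
      have h4 : |a i| ≤ |a i + b i| + |b i| := by
        simpa using this
      simp only [ne_eq, h0, not_false_eq_true, if_true]
      linarith
  have hsum := Finset.sum_le_sum fun i (_ : i ∈ Finset.univ) => key i
  rw [Finset.sum_add_distrib, Finset.sum_sub_distrib, ← Finset.mul_sum, ← Finset.sum_filter,
    Finset.sum_const, nsmul_eq_mul] at hsum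
  have hs' : ((sparsity a : ℕ) : ℝ) * M ≤ s * M :=
    mul_le_mul_of_nonneg_right (by exact_mod_cast hs) hM
  unfold l1 at *
  unfold sparsity at hs'
  linarith

lemma column_bound {N : ℕ} (r β s : ℕ) (hβ : β ≤ r) (δ : ℝ) (hδ : 0 < δ)
    (x q y : Fin N → ℝ)
    (hs : sparsity (((Dmat N ^ β)ᵀ).mulVec x) ≤ s)
    (hx : ∀ i, |(((Dmat N)⁻¹ ^ r).mulVec (x - q)) i| ≤ δ / 2)
    (hy : ∀ i, |(((Dmat N)⁻¹ ^ r).mulVec (y - q)) i| ≤ δ / 2)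
    (hmin : l1 (((Dmat N ^ β)ᵀ).mulVec y) ≤ l1 (((Dmat N ^ β)ᵀ).mulVec x)) :
    ∑ i, (y i - x i) ^ 2 ≤ (2 ^ (r + 1)) ^ 2 * s * δ ^ 2 := by
  obtain ⟨k, rfl⟩ := Nat.exists_eq_add_of_le hβ
  set h := y - x with hh
  set u := ((Dmat N)⁻¹ ^ (β + k)).mulVec h with hu
  have hub : ∀ i, |u i| ≤ δ := by
    intro i
    have : u i = (((Dmat N)⁻¹ ^ (β + k)).mulVec (y - q)) i
        - (((Dmat N)⁻¹ ^ (β + k)).mulVec (x - q)) i := by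
      rw [← Pi.sub_apply, ← Matrix.mulVec_sub, hu, hh, sub_sub_sub_cancel_right]
    rw [this]
    refine (abs_sub _ _).trans ?_
    linarith [hx i, hy i]
  have hdet : IsUnit (Dmat N).det := by rw [Dmat_det]; exact isUnit_one
  have hinv : h = (Dmat N ^ (β + k)).mulVec u := by
    rw [hu, Matrix.mulVec_mulVec, Matrix.inv_pow', Matrix.mul_nonsing_inv, Matrix.one_mulVec]
    rw [Matrix.det_pow]; exact hdet.pow _
  set w := (Dmat N ^ k).mulVec u with hw
  have hwb : ∀ i, |w i| ≤ 2 ^ k * δ := pow_mulVec_bound _ Dmat_row k u δ hub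
  have hhw : h = (Dmat N ^ β).mulVec w := by
    rw [hw, Matrix.mulVec_mulVec, ← pow_add]; exact hinv
  have hhb : ∀ i, |h i| ≤ 2 ^ (β + k) * δ := by
    rw [hinv]; exact pow_mulVec_bound _ Dmat_row _ u δ hub
  set b := ((Dmat N ^ β)ᵀ).mulVec h with hb
  have hbb : ∀ i, |b i| ≤ 2 ^ β * (2 ^ (β + k) * δ) := by
    rw [hb, Matrix.transpose_pow]
    exact pow_mulVec_bound _ (fun i => Dmat_col i) _ h _ hhb
  have hl1 : l1 b ≤ 2 * (s * (2 ^ β * (2 ^ (β + k) * δ))) := by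
    apply cone (((Dmat N ^ β)ᵀ).mulVec x) b _ s hs (by positivity) hbb
    rw [hb, ← Matrix.mulVec_add, hh]
    simpa using hmin
  have hdot : ∑ i, (y i - x i) ^ 2 = ∑ i, w i * b i := by
    calc ∑ i, (y i - x i) ^ 2 = h ⬝ᵥ h := by simp [dotProduct, hh, sq]
      _ = ((Dmat N ^ β).mulVec w) ⬝ᵥ h := by rw [← hhw]
      _ = w ⬝ᵥ b := by
        rw [hb, Matrix.dotProduct_mulVec, Matrix.vecMul_transpose]
      _ = _ := rfl
  rw [hdot]
  calc ∑ i, w i * b i ≤ ∑ i, (2 ^ k * δ) * |b i| := Finset.sum_le_sum fun i _ => by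
        refine (le_abs_self _).trans ?_
        rw [abs_mul]
        exact mul_le_mul_of_nonneg_right (hwb i) (abs_nonneg _)
    _ = (2 ^ k * δ) * l1 b := by rw [← Finset.mul_sum]; rfl
    _ ≤ (2 ^ k * δ) * (2 * (s * (2 ^ β * (2 ^ (β + k) * δ)))) :=
        mul_le_mul_of_nonneg_left hl1 (by positivity)
    _ ≤ 2 * ((2 ^ k * δ) * (2 * (s * (2 ^ β * (2 ^ (β + k) * δ))))) :=
        le_mul_of_one_le_left (by positivity) (by norm_num)
    _ = _ := by ring

/-- for every order `r` there is a constant `C` (depending only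
on `r`) such that column-by-column `r`-th order Sigma Delta quantization and
TV decoding of an image whose columns have `s`-sparse `β`-th differences
satisfies `‖X̂ - X‖_F ≤ C √(s N) δ`. -/
theorem sigma_delta_columnwise_image_error (r : ℕ) :
    ∃ C : ℝ, 0 < C ∧
      ∀ (N β s : ℕ), (β = 1 ∨ β = 2) → β ≤ r →
      ∀ (δ : ℝ), 0 < δ →
      ∀ (X q Xhat : Matrix (Fin N) (Fin N) ℝ),
        (∀ i j, X i j ∈ Set.Icc (0 : ℝ) 1) →
        (∀ j : Fin N, sparsity (((Dmat N ^ β)ᵀ).mulVec (fun i => X i j)) ≤ s) →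
        (∀ j : Fin N, ∀ i : Fin N,
          |(((Dmat N)⁻¹ ^ r).mulVec ((fun i' => X i' j) - (fun i' => q i' j))) i| ≤ δ / 2) →
        (∀ j : Fin N, ∀ i : Fin N,
          |(((Dmat N)⁻¹ ^ r).mulVec ((fun i' => Xhat i' j) - (fun i' => q i' j))) i| ≤ δ / 2) →
        (∀ j : Fin N, ∀ z : Fin N → ℝ,
          (∀ i : Fin N, |(((Dmat N)⁻¹ ^ r).mulVec (z - (fun i' => q i' j))) i| ≤ δ / 2) →
          l1 (((Dmat N ^ β)ᵀ).mulVec (fun i => Xhat i j)) ≤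
            l1 (((Dmat N ^ β)ᵀ).mulVec z)) →
        frob (Xhat - X) ≤ C * Real.sqrt ((s : ℝ) * N) * δ := by
  refine ⟨2 ^ (r + 1), by positivity, ?_⟩
  intro N β s _ hβr δ hδ X q Y _ hs hx hy hmin
  have hcol : ∀ j : Fin N, ∑ i, (Y i j - X i j) ^ 2 ≤ (2 ^ (r + 1)) ^ 2 * s * δ ^ 2 :=
    fun j => column_bound r β s hβr δ hδ (fun i => X i j) (fun i => q i j) (fun i => Y i j)
      (hs j) (hx j) (hy j) (hmin j _ (hx j))
  unfold frob
  apply Real.sqrt_le_iff.2 ⟨by positivity, ?_⟩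
  rw [mul_pow, mul_pow, Real.sq_sqrt (by positivity), Finset.sum_comm]
  calc ∑ j, ∑ i, ((Y - X) i j) ^ 2 ≤ ∑ _j : Fin N, (2 ^ (r + 1)) ^ 2 * (s : ℝ) * δ ^ 2 :=
        Finset.sum_le_sum fun j _ => hcol j
    _ = _ := by
        rw [Finset.sum_const, Finset.card_univ, Fintype.card_fin, nsmul_eq_mul]; ring
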